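/- Let c₁ ≠ 0 and c₂ be real with Δ = c₂² − 4c₁ > 0, set π± = −1 + (−c₂ ± √Δ)/(2c₁), λ± = (3/2)·(1 ± (c₂+2)/√Δ), and define the reduced indicatrix χ̄(π) = (c₁/3)·(π − π₊)·(π − π₋). Let f₀, e₀ > 0 and let I ⊆ (−1,∞) be an open interval on which π − π₊ > 0 and π − π₋ > 0. Then the functions f(π) = f₀·((π−π₊)/(π−π₋))^(3/√Δ) and e(π) = e₀·(π−π₊)^(λ₊)·(π−π₋)^(λ₋)·(π+1)^(−3) are differentiable on I and satisfy the generating ODEs f′(π)·χ̄(π) = f(π) and e′(π)·χ̄(π)·(π+1) = π·e(π) for all π ∈ I. -/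

import Mathlib

/-- Derivative of a real power of an affine function, in logarithmic form. -/
theorem hasDerivAt_sub_rpow_log (a r x : ℝ) (h : 0 < x - a) :
    HasDerivAt (fun y : ℝ => (y - a) ^ r) ((x - a) ^ r * (r / (x - a))) x := by
  have h1 := ((hasDerivAt_id x).sub_const a).rpow_const (p := r) (Or.inl h.ne')
  refine h1.congr_deriv ?_
  simp only [id]
  rw [Real.rpow_sub_one h.ne']
  ring

/-- Class 4 of Proposition 5 (`Δ = c₂² − 4c₁ > 0`, `c₁ ≠ 0`, reduced indicatrix
`χ̄(π) = (c₁/3)(π−π₊)(π−π₋)`): the generating functions satisfy the generating ODEs. -/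
theorem stmt_7
    (c₁ c₂ : ℝ) (hc₁ : c₁ ≠ 0)
    (Δ : ℝ) (hΔdef : Δ = c₂^2 - 4 * c₁) (hΔ : 0 < Δ)
    (πp πm lp lm : ℝ)
    (hπp : πp = -1 + (-c₂ + Real.sqrt Δ) / (2 * c₁))
    (hπm : πm = -1 + (-c₂ - Real.sqrt Δ) / (2 * c₁))
    (hlp : lp = (3/2) * (1 + (c₂ + 2) / Real.sqrt Δ))
    (hlm : lm = (3/2) * (1 - (c₂ + 2) / Real.sqrt Δ))
    (f₀ e₀ : ℝ) (hf₀ : 0 < f₀) (he₀ : 0 < e₀)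
    (I : Set ℝ) (hIint : ∃ u v : ℝ, I = Set.Ioo u v)
    (hIsub : I ⊆ Set.Ioi (-1 : ℝ))
    (hIp : ∀ π ∈ I, 0 < π - πp)
    (hIm : ∀ π ∈ I, 0 < π - πm)
    (χbar f e : ℝ → ℝ)
    (hχbar : ∀ π : ℝ, χbar π = (c₁ / 3) * (π - πp) * (π - πm))
    (hfdef : ∀ π : ℝ, f π = f₀ * ((π - πp) / (π - πm)) ^ (3 / Real.sqrt Δ))
    (hedef : ∀ π : ℝ, e π =
      e₀ * (π - πp) ^ lp * (π - πm) ^ lm * (π + 1) ^ (-3 : ℝ)) :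
    ∀ π ∈ I,
      DifferentiableAt ℝ f π ∧ DifferentiableAt ℝ e π ∧
      deriv f π * χbar π = f π ∧
      deriv e π * χbar π * (π + 1) = π * e π := by
  intro x hx
  have hP := hIp x hx
  have hM := hIm x hx
  have hx1 : 0 < x - (-1) := by
    have := hIsub hx
    simp only [Set.mem_Ioi] at this
    linarith
  have hs : 0 < Real.sqrt Δ := Real.sqrt_pos.2 hΔ
  have hs2 : Real.sqrt Δ ^ 2 = c₂ ^ 2 - 4 * c₁ := by rw [Real.sq_sqrt hΔ.le, hΔdef]
  generalize Real.sqrt Δ = s at *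
  have hs0 := hs.ne'
  have hdiff : c₁ * (πp - πm) = s := by
    rw [hπp, hπm]; field_simp; ring
  have hprod : c₁ * ((πp + 1) * (πm + 1)) = 1 := by
    rw [hπp, hπm]; field_simp; linear_combination -hs2
  have hsum : lp + lm = 3 := by rw [hlp, hlm]; ring
  have hweighted : c₁ * (lp * (πp + 1) + lm * (πm + 1)) = 3 := by
    rw [hπp, hπm, hlp, hlm]; field_simp; ring
  have hf : HasDerivAt f (f x * ((3 / s) / (x - πp) - (3 / s) / (x - πm))) x := by
    have h1 := (((hasDerivAt_id x).sub_const πp).div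
      ((hasDerivAt_id x).sub_const πm) hM.ne').rpow_const (p := 3 / s)
      (Or.inl (div_pos hP hM).ne')
    rw [funext hfdef]
    refine (h1.const_mul f₀).congr_deriv ?_
    simp only [id, Pi.div_apply]
    rw [Real.rpow_sub_one (div_pos hP hM).ne']
    field_simp
  have he : HasDerivAt e (e x * (lp / (x - πp) + lm / (x - πm) - 3 / (x + 1))) x := by
    have h1 := (((hasDerivAt_sub_rpow_log πp lp x hP).const_mul e₀).mul
      (hasDerivAt_sub_rpow_log πm lm x hM)).mul (hasDerivAt_sub_rpow_log (-1) (-3) x hx1)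
    simp only [sub_neg_eq_add] at h1
    rw [funext hedef]
    refine h1.congr_deriv ?_
    simp only [Pi.mul_apply]
    ring
  have hx1' : 0 < x + 1 := by linarith
  refine ⟨hf.differentiableAt, he.differentiableAt, ?_, ?_⟩
  · rw [hf.deriv, hχbar]
    have h : ((3 / s) / (x - πp) - (3 / s) / (x - πm)) *
        ((c₁ / 3) * (x - πp) * (x - πm)) = 1 := by
      have := hP.ne'
      have := hM.ne'
      field_simp
      linear_combination hdiff
    rw [mul_assoc, h, mul_one]
  · rw [he.deriv, hχbar]
    have h : (lp / (x - πp) + lm / (x - πm) - 3 / (x + 1)) *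
        ((c₁ / 3) * (x - πp) * (x - πm)) * (x + 1) = x := by
      have := hP.ne'
      have := hM.ne'
      have := hx1'.ne'
      field_simp
      linear_combination (x + 1) * hweighted - 3 * hprod +
        c₁ * (x + 1) * (x - πp - πm - 1) * hsum
    linear_combination e x * h
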